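/- Fix D > 0 and let ι(w) = −w·log₂ w. Then as c → ∞, c·D · [ (2/D)·∫₀^{D/2} ι( 1 − Φ(c·x) − Φ(c·D − c·x) ) dx ] converges to 2·∫₀^∞ ι(1 − Φ(x)) dx. (The bracketed quantity is M₀, the contribution of the event h(p) − h(q) = 0 to the conditional entropy of the interval-hash difference for points p, q at distance 1/c, given the offset r(q) of q within its length-D interval.) -/

import Mathlib

open Filter

/-- `Φ(x)`: the upper tail of the standard normal distribution. -/
noncomputable def stdNormalTail (x : ℝ) : ℝ :=
  (Real.sqrt (2 * Real.pi))⁻¹ * ∫ t in Set.Ioi x, Real.exp (-(t ^ 2) / 2)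

/-- `ι(w) = −w·log₂ w`, with the convention `ι(0) = 0`. -/
noncomputable def entTerm (w : ℝ) : ℝ := -(w * Real.logb 2 w)

open MeasureTheory

lemma integrable_exp_neg_sq_div_two : Integrable fun t : ℝ => Real.exp (-(t ^ 2) / 2) := by
  convert integrable_exp_neg_mul_sq (b := 1 / 2) (by norm_num) using 3
  ring

lemma stdNormalTail_nonneg (x : ℝ) : 0 ≤ stdNormalTail x :=
  mul_nonneg (by positivity) (integral_nonneg fun _ => (Real.exp_pos _).le)

lemma stdNormalTail_antitone : Antitone stdNormalTail := fun _ _ hxy =>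
  mul_le_mul_of_nonneg_left
    (setIntegral_mono_set integrable_exp_neg_sq_div_two.integrableOn
      (Eventually.of_forall fun _ => (Real.exp_pos _).le)
      (Set.Ioi_subset_Ioi hxy).eventuallyLE)
    (by positivity)

lemma stdNormalTail_zero : stdNormalTail 0 = 1 / 2 := by
  have h := integral_gaussian_Ioi (1 / 2)
  have h2 : Real.pi / (1 / 2) = 2 * Real.pi := by ring
  have h3 : Real.sqrt (2 * Real.pi) ≠ 0 := by positivity
  have h4 : (fun t : ℝ => Real.exp (-(t ^ 2) / 2)) = fun t => Real.exp (-(1 / 2) * t ^ 2) := by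
    ext t
    ring_nf
  rw [stdNormalTail, h4, h, h2]
  field_simp

lemma stdNormalTail_le_half {x : ℝ} (hx : 0 ≤ x) : stdNormalTail x ≤ 1 / 2 :=
  stdNormalTail_zero ▸ stdNormalTail_antitone hx

lemma stdNormalTail_le_exp_neg (x : ℝ) :
    stdNormalTail x ≤ (Real.sqrt (2 * Real.pi))⁻¹ * Real.exp (1 / 2) * Real.exp (-x) := by
  rw [stdNormalTail, mul_assoc]
  refine mul_le_mul_of_nonneg_left ?_ (by positivity)
  rw [← integral_exp_neg_Ioi x, ← integral_const_mul]
  refine setIntegral_mono integrable_exp_neg_sq_div_two.integrableOn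
    ((integrableOn_exp_neg_Ioi x).const_mul _) fun t => ?_
  rw [← Real.exp_add]
  exact Real.exp_le_exp.2 (by nlinarith [sq_nonneg (t - 1)])

lemma tendsto_stdNormalTail_atTop : Tendsto stdNormalTail atTop (nhds 0) := by
  refine squeeze_zero stdNormalTail_nonneg stdNormalTail_le_exp_neg ?_
  simpa using Real.tendsto_exp_neg_atTop_nhds_zero.const_mul
    ((Real.sqrt (2 * Real.pi))⁻¹ * Real.exp (1 / 2))

lemma entTerm_eq (w : ℝ) : entTerm w = Real.negMulLog w / Real.log 2 := by
  rw [entTerm, Real.logb, Real.negMulLog]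
  ring

lemma continuous_entTerm : Continuous entTerm := by
  rw [funext entTerm_eq]
  fun_prop

lemma abs_entTerm_le {w : ℝ} (h0 : 0 ≤ w) (h1 : w ≤ 1) : |entTerm w| ≤ (1 - w) / Real.log 2 := by
  have h2 : 0 < Real.log 2 := Real.log_pos (by norm_num)
  rw [entTerm_eq, abs_of_nonneg (div_nonneg (Real.negMulLog_nonneg h0 h1) h2.le)]
  exact div_le_div_of_nonneg_right (Real.negMulLog_le_one_sub_self h0) h2.le

lemma tendsto_integral_entTerm_stdNormalTail :
    Tendsto (fun L : ℝ => ∫ y in (0 : ℝ)..(L / 2),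
        entTerm (1 - stdNormalTail y - stdNormalTail (L - y)))
      atTop (nhds (∫ y in Set.Ioi (0 : ℝ), entTerm (1 - stdNormalTail y))) := by
  have hlog : 0 < Real.log 2 := Real.log_pos (by norm_num)
  have hmeas := stdNormalTail_antitone.measurable
  have key : Tendsto (fun L : ℝ => ∫ y in Set.Ioi (0 : ℝ), (Set.Iic (L / 2)).indicator
      (fun y => entTerm (1 - stdNormalTail y - stdNormalTail (L - y))) y)
      atTop (nhds (∫ y in Set.Ioi (0 : ℝ), entTerm (1 - stdNormalTail y))) := by
    refine tendsto_integral_filter_of_dominated_convergence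
      (fun y => 2 * ((Real.sqrt (2 * Real.pi))⁻¹ * Real.exp (1 / 2) * Real.exp (-y)) / Real.log 2)
      ?_ ?_ ?_ ?_
    · refine Eventually.of_forall fun L => Measurable.aestronglyMeasurable ?_
      refine Measurable.indicator (continuous_entTerm.measurable.comp ?_) measurableSet_Iic
      exact (measurable_const.sub hmeas).sub (hmeas.comp (measurable_const.sub measurable_id))
    · refine Eventually.of_forall fun L => ?_
      filter_upwards [ae_restrict_mem measurableSet_Ioi] with y hy
      rw [Set.mem_Ioi] at hy
      by_cases hL : y ∈ Set.Iic (L / 2)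
      · rw [Set.indicator_of_mem hL, Real.norm_eq_abs]
        rw [Set.mem_Iic] at hL
        have hle := stdNormalTail_antitone (show y ≤ L - y by linarith)
        have hhalf := stdNormalTail_le_half hy.le
        have hexp := stdNormalTail_le_exp_neg y
        refine (abs_entTerm_le (by linarith)
          (by linarith [stdNormalTail_nonneg y, stdNormalTail_nonneg (L - y)])).trans ?_
        exact div_le_div_of_nonneg_right (by linarith) hlog.le
      · rw [Set.indicator_of_notMem hL, norm_zero]
        positivity
    · exact (((integrableOn_exp_neg_Ioi 0).const_mul _).const_mul _).div_const _
    · refine Eventually.of_forall fun y => ?_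
      have hlim : Tendsto (fun L : ℝ => entTerm (1 - stdNormalTail y - stdNormalTail (L - y)))
          atTop (nhds (entTerm (1 - stdNormalTail y))) := by
        refine (continuous_entTerm.tendsto _).comp ?_
        simpa [← sub_eq_add_neg] using tendsto_const_nhds.sub (tendsto_stdNormalTail_atTop.comp
          (tendsto_atTop_add_const_right atTop (-y) tendsto_id))
      refine hlim.congr' ?_
      filter_upwards [eventually_ge_atTop (2 * y)] with L hL
      rw [Set.indicator_of_mem (Set.mem_Iic.2 (by linarith))]
  refine key.congr' ?_
  filter_upwards [eventually_ge_atTop 0] with L hL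
  rw [intervalIntegral.integral_of_le (by linarith), setIntegral_indicator measurableSet_Iic,
    Set.Ioi_inter_Iic]

/-- Asymptotics of `M₀`, the contribution of the event `h(p) − h(q) = 0` to the
conditional entropy of the interval-hash difference: as `c → ∞`,
`c·D · [(2/D)·∫₀^{D/2} ι(1 − Φ(c·x) − Φ(c·D − c·x)) dx]` converges to
`2·∫₀^∞ ι(1 − Φ(x)) dx`. -/
theorem interval_hash_M0_limit (D : ℝ) (hD : 0 < D) :
    Tendsto (fun c : ℝ => c * D *
        ((2 / D) * ∫ x in (0 : ℝ)..(D / 2),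
          entTerm (1 - stdNormalTail (c * x) - stdNormalTail (c * D - c * x))))
      atTop (nhds (2 * ∫ x in Set.Ioi (0 : ℝ), entTerm (1 - stdNormalTail x))) := by
  have h := (tendsto_integral_entTerm_stdNormalTail.comp
    (tendsto_id.atTop_mul_const hD)).const_mul 2
  refine h.congr' ?_
  filter_upwards [eventually_gt_atTop 0] with c hc
  have hsub := intervalIntegral.mul_integral_comp_mul_left (a := 0) (b := D / 2)
    (f := fun y => entTerm (1 - stdNormalTail y - stdNormalTail (c * D - y))) (c := c)
  rw [mul_zero, ← mul_div_assoc] at hsub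
  simp only [Function.comp_apply, id_eq, ← hsub]
  field_simp
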